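/- If m is even, then every contiguous stepping sequence for m begins with an odd integer and ends with an odd integer. -/

import Mathlib

open List

/-- The initial configuration `(1, 2, …, m)`. -/
def initConfig (m : ℕ) : List ℕ := (List.range m).map (· + 1)

/-- A move at index `i` (with `1 ≤ i ≤ m-1`) transposes the entries `q_i` and `q_{i+1}`
(one-indexed), i.e. the entries at zero-indexed positions `i-1` and `i`. -/
def swapAdj (q : List ℕ) (i : ℕ) : List ℕ :=
  (q.set (i - 1) (q.getD i 0)).set i (q.getD (i - 1) 0)

/-- The prefix set `S_k(q) = {q_1, …, q_k}`. -/
def prefixSet (q : List ℕ) (k : ℕ) : Finset ℕ := (q.take k).toFinset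

/-- The initial prefix sets `S_0 ⊂ S_1 ⊂ … ⊂ S_m` of the configuration `(1,…,m)`. -/
def initSets (m : ℕ) : List (Finset ℕ) :=
  (List.range (m + 1)).map (fun k => prefixSet (initConfig m) k)

/-- The sets generated by applying a sequence of moves starting from configuration `q`:
the `t`-th generated set is the prefix set of length `i_t` of the configuration
obtained after the `t`-th move. -/
def genSetsAux (q : List ℕ) : List ℕ → List (Finset ℕ)
  | [] => []
  | i :: rest => prefixSet (swapAdj q i) i :: genSetsAux (swapAdj q i) rest

/-- The sets generated by the moves, starting from the initial configuration `(1,…,m)`. -/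
def genSets (m : ℕ) (moves : List ℕ) : List (Finset ℕ) :=
  genSetsAux (initConfig m) moves

/-- `moves` is a stepping sequence for `m`: each move index lies in `{1,…,m-1}`, and the
initial prefix sets `S_0,…,S_m` together with the generated sets list every subset of
`{1,…,m}` exactly once. -/
def IsSteppingSeq (m : ℕ) (moves : List ℕ) : Prop :=
  (∀ i ∈ moves, 1 ≤ i ∧ i ≤ m - 1) ∧
  (initSets m ++ genSets m moves).Perm (Finset.Icc 1 m).powerset.toList

/-- A list of moves is contiguous if consecutive entries differ by exactly 1. -/
def ContiguousList (G : List ℕ) : Prop :=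
  ∀ t, t + 1 < G.length → ((G.getD t 0 : ℤ) - (G.getD (t + 1) 0 : ℤ)).natAbs = 1

/-- A stepping sequence for `m` is strongly contiguous if it is contiguous, begins
with `m-1`, and ends with `1`. -/
def StronglyContiguous (m : ℕ) (G : List ℕ) : Prop :=
  ContiguousList G ∧ G.head? = some (m - 1) ∧ G.getLast? = some 1

theorem swapAdj_perm {q : List ℕ} {i : ℕ} (hi : i < q.length) : (swapAdj q i).Perm q := by
  have hi' : i - 1 < q.length := by omega
  simpa [swapAdj, hi, hi'] using List.set_set_perm hi' hi

theorem card_prefixSet {q : List ℕ} (hq : q.Nodup) {k : ℕ} (hk : k ≤ q.length) :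
    (prefixSet q k).card = k := by
  rw [prefixSet, List.toFinset_card_of_nodup (hq.sublist (List.take_sublist k q))]
  simpa using hk

theorem map_card_genSetsAux {G : List ℕ} {q : List ℕ} (hq : q.Nodup)
    (hG : ∀ i ∈ G, i < q.length) : (genSetsAux q G).map Finset.card = G := by
  induction G generalizing q with
  | nil => rfl
  | cons i G ih =>
    have hp := swapAdj_perm (hG i (by simp))
    have hn := hp.nodup_iff.mpr hq
    rw [genSetsAux, List.map_cons, card_prefixSet hn (by rw [hp.length_eq]; exact (hG i (by simp)).le),
      ih hn fun j hj => by rw [hp.length_eq]; exact hG j (by simp [hj])]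

theorem length_initConfig (m : ℕ) : (initConfig m).length = m := by simp [initConfig]

theorem nodup_initConfig (m : ℕ) : (initConfig m).Nodup :=
  List.nodup_range.map (add_left_injective 1)

theorem map_card_initSets (m : ℕ) : (initSets m).map Finset.card = List.range (m + 1) := by
  rw [initSets, List.map_map]
  refine (List.map_congr_left fun k hk => ?_).trans (List.map_id _)
  refine card_prefixSet (nodup_initConfig m) ?_
  rw [length_initConfig]
  exact Nat.lt_succ_iff.mp (List.mem_range.mp hk)

/-- The signed count of the moves of a stepping sequence, by parity of the index. -/
theorem IsSteppingSeq.sum_neg_one_pow {m : ℕ} (hm : 2 ≤ m) (hme : Even m) {G : List ℕ}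
    (hG : IsSteppingSeq m G) : (G.map fun i => (-1 : ℤ) ^ i).sum = -1 := by
  have hcard : (genSets m G).map Finset.card = G :=
    map_card_genSetsAux (nodup_initConfig m) fun i hi => by
      have := hG.1 i hi
      rw [length_initConfig]
      omega
  have hinit : ((List.range (m + 1)).map fun k => (-1 : ℤ) ^ k).sum = 1 := by
    change ∑ k ∈ Finset.range (m + 1), (-1 : ℤ) ^ k = 1
    simp [neg_one_geom_sum, hme, Nat.even_add_one]
  have hpow : ∑ s ∈ (Finset.Icc 1 m).powerset, (-1 : ℤ) ^ s.card = 0 :=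
    Finset.sum_powerset_neg_one_pow_card_of_nonempty (Finset.nonempty_Icc.mpr (by omega))
  have h := ((hG.2.map Finset.card).map fun k => (-1 : ℤ) ^ k).sum_eq
  rw [List.map_append, map_card_initSets, hcard, List.map_append, List.sum_append, hinit,
    List.map_map] at h
  have hlist := Finset.sum_map_toList (Finset.Icc 1 m).powerset fun s => (-1 : ℤ) ^ s.card
  rw [hpow] at hlist
  have := h.trans hlist
  omega

theorem ContiguousList.tail {a : ℕ} {G : List ℕ} (h : ContiguousList (a :: G)) :
    ContiguousList G := fun t ht => by
  simpa using h (t + 1) (by simpa using ht)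

/-- In a contiguous list the parities alternate, so the signed count telescopes. -/
theorem ContiguousList.two_mul_sum_neg_one_pow {a : ℕ} {G : List ℕ}
    (h : ContiguousList (a :: G)) :
    2 * ((a :: G).map fun i => (-1 : ℤ) ^ i).sum =
      (-1) ^ a + (-1) ^ (a :: G).getLast (List.cons_ne_nil a G) := by
  induction G generalizing a with
  | nil => simp [two_mul]
  | cons b G ih =>
    have hab := h 0 (by simp)
    have hsign : (-1 : ℤ) ^ a = -(-1) ^ b := by
      simp only [List.getD_cons_zero, List.getD_cons_succ, zero_add] at hab
      obtain rfl | rfl : a = b + 1 ∨ b = a + 1 := by omega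
      all_goals ring
    rw [List.map_cons, List.sum_cons, mul_add, ih h.tail, List.getLast_cons_cons, hsign]
    ring

/-- Lemma 6.3: if `m` is even, then every contiguous stepping sequence for `m` begins
with an odd integer and ends with an odd integer. -/
theorem contiguous_first_last_odd (m : ℕ) (hm : 2 ≤ m) (hme : Even m) (G : List ℕ)
    (hG : IsSteppingSeq m G) (hc : ContiguousList G) :
    (∃ a, G.head? = some a ∧ Odd a) ∧ (∃ b, G.getLast? = some b ∧ Odd b) := by
  have hsum := hG.sum_neg_one_pow hm hme
  cases G with
  | nil => simp at hsum
  | cons a G =>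
    have h := hc.two_mul_sum_neg_one_pow
    rw [hsum] at h
    refine ⟨⟨a, rfl, ?_⟩, ⟨_, List.getLast?_eq_some_getLast (List.cons_ne_nil a G), ?_⟩⟩ <;>
      rw [← neg_one_pow_eq_neg_one_iff_odd (R := ℤ) (by decide)] <;>
      rcases neg_one_pow_eq_or ℤ a with ha | ha <;>
      rcases neg_one_pow_eq_or ℤ ((a :: G).getLast (List.cons_ne_nil a G)) with hb | hb <;>
      omega
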